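/- arXiv:1912.11919 — 8 statements merged into one kernel-verified Lean document; each statement's English description precedes it below -/
import Mathlib

section
/- Let τ > 0 and let y : ℝ → ℝ be three times continuously differentiable on [0, τ]. Then there exists a constant C ≥ 0 such that for every even integer n ≥ 2, setting h = τ/n and letting y_n(t) = Σ_{i=0}^{n} y(ih) ψ_i^M(t) be the modified-hat-function interpolant of y, one has |y(t) − y_n(t)| ≤ C h³ for all t ∈ [0, τ]. -/
/-- The modified hat functions on `[0, τ]` with `n` (even) subintervals of length `h = τ/n`. -/
noncomputable def psiM (τ : ℝ) (n : ℕ) (i : ℕ) : ℝ → ℝ := fun t =>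
  if i = 0 then
    if 0 ≤ t ∧ t ≤ 2 * (τ / n) then
      (1 / (2 * (τ / n) ^ 2)) * (t - τ / n) * (t - 2 * (τ / n)) else 0
  else if i = n then
    if τ - 2 * (τ / n) ≤ t ∧ t ≤ τ then
      (1 / (2 * (τ / n) ^ 2)) * (t - (τ - τ / n)) * (t - (τ - 2 * (τ / n))) else 0
  else if i % 2 = 1 then
    if ((i : ℝ) - 1) * (τ / n) ≤ t ∧ t ≤ ((i : ℝ) + 1) * (τ / n) then
      -(1 / (τ / n) ^ 2) * (t - ((i : ℝ) - 1) * (τ / n)) * (t - ((i : ℝ) + 1) * (τ / n)) else 0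
  else
    if ((i : ℝ) - 2) * (τ / n) ≤ t ∧ t ≤ (i : ℝ) * (τ / n) then
      (1 / (2 * (τ / n) ^ 2)) * (t - ((i : ℝ) - 1) * (τ / n)) * (t - ((i : ℝ) - 2) * (τ / n))
    else if (i : ℝ) * (τ / n) ≤ t ∧ t ≤ ((i : ℝ) + 2) * (τ / n) then
      (1 / (2 * (τ / n) ^ 2)) * (t - ((i : ℝ) + 1) * (τ / n)) * (t - ((i : ℝ) + 2) * (τ / n))
    else 0

lemma psiM_scaled (h : ℝ) (hh : 0 < h) (n : ℕ) (hn : 0 < n) (i : ℕ) (s : ℝ) :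
    psiM (n * h) n i (s * h) =
      if i = 0 then (if 0 ≤ s ∧ s ≤ 2 then (s - 1) * (s - 2) / 2 else 0)
      else if i = n then
        (if (n : ℝ) - 2 ≤ s ∧ s ≤ n then (s - (n - 1)) * (s - (n - 2)) / 2 else 0)
      else if i % 2 = 1 then
        (if (i : ℝ) - 1 ≤ s ∧ s ≤ (i : ℝ) + 1 then -((s - (i - 1)) * (s - (i + 1))) else 0)
      else if (i : ℝ) - 2 ≤ s ∧ s ≤ i then (s - (i - 1)) * (s - (i - 2)) / 2
      else if (i : ℝ) ≤ s ∧ s ≤ (i : ℝ) + 2 then (s - (i + 1)) * (s - (i + 2)) / 2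
      else 0 := by
  have hn' : (n : ℝ) ≠ 0 := by positivity
  have e : (n * h) / (n : ℝ) = h := by field_simp
  have c0 : 0 ≤ s * h ↔ 0 ≤ s := by
    constructor
    · intro H; exact nonneg_of_mul_nonneg_left H hh
    · intro H; positivity
  have e1 : (n : ℝ) * h - 2 * h = (n - 2) * h := by ring
  unfold psiM
  simp only [e, e1, c0, mul_le_mul_iff_left₀ hh]
  split_ifs <;> field_simp

lemma psiM_zero (h : ℝ) (hh : 0 < h) (m k i : ℕ) (hk : k ≤ m) (u : ℝ) (hu0 : 0 ≤ u) (hu2 : u ≤ 2)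
    (h0 : i ≠ 2 * k) (h1 : i ≠ 2 * k + 1) (h2 : i ≠ 2 * k + 2) :
    psiM (((2 * (m + 1) : ℕ) : ℝ) * h) (2 * (m + 1)) i ((2 * k + u) * h) = 0 := by
  rw [psiM_scaled h hh _ (by omega)]
  have hlt : i + 1 ≤ 2 * k ∨ 2 * k + 3 ≤ i := by omega
  have hpar : i % 2 = 1 ∨ (i + 2 ≤ 2 * k ∨ 2 * k + 4 ≤ i) := by omega
  by_cases hi0 : i = 0
  · have hk1 : (1 : ℝ) ≤ k := by exact_mod_cast (by omega : 1 ≤ k)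
    rw [if_pos hi0]
    split_ifs with H
    · have : 2 * (k : ℝ) + u = 2 := by linarith [H.2]
      rw [this]; ring
    · rfl
  rw [if_neg hi0]
  by_cases hin : i = 2 * (m + 1)
  · have hk1 : (k : ℝ) + 1 ≤ m := by exact_mod_cast (by omega : k + 1 ≤ m)
    rw [if_pos hin]
    push_cast
    split_ifs with H
    · have : 2 * (k : ℝ) + u = 2 * (m + 1) - 2 := by linarith [H.1]
      rw [this]; ring
    · rfl
  rw [if_neg hin]
  by_cases ho : i % 2 = 1
  · rw [if_pos ho]
    split_ifs with H
    · rcases hlt with hl | hl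
      · have : (i : ℝ) + 1 ≤ 2 * k := by exact_mod_cast hl
        have : 2 * (k : ℝ) + u = i + 1 := by linarith [H.2]
        rw [this]; ring
      · have : 2 * (k : ℝ) + 3 ≤ i := by exact_mod_cast hl
        have : 2 * (k : ℝ) + u = i - 1 := by linarith [H.1]
        rw [this]; ring
    · rfl
  rw [if_neg ho]
  rcases hpar.resolve_left ho with hl | hl
  · have : (i : ℝ) + 2 ≤ 2 * k := by exact_mod_cast hl
    rw [if_neg (by intro H; linarith [H.2])]
    split_ifs with H
    · have : 2 * (k : ℝ) + u = i + 2 := by linarith [H.2]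
      rw [this]; ring
    · rfl
  · have : 2 * (k : ℝ) + 4 ≤ i := by exact_mod_cast hl
    split_ifs with H H'
    · have : 2 * (k : ℝ) + u = i - 2 := by linarith [H.1]
      rw [this]; ring
    · linarith [H'.1]
    · rfl

lemma psiM_left (h : ℝ) (hh : 0 < h) (m k : ℕ) (hk : k ≤ m) (u : ℝ) (hu0 : 0 ≤ u) (hu2 : u ≤ 2) :
    psiM (((2 * (m + 1) : ℕ) : ℝ) * h) (2 * (m + 1)) (2 * k) ((2 * k + u) * h)
      = (u - 1) * (u - 2) / 2 := by
  rw [psiM_scaled h hh _ (by omega)]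
  by_cases hk0 : k = 0
  · subst hk0
    simp [hu0, hu2]
  rw [if_neg (by omega), if_neg (by omega), if_neg (by omega)]
  push_cast
  split_ifs with H H'
  · have : u = 0 := by linarith [H.2]
    subst this; ring
  · ring
  · exact absurd ⟨by linarith, by linarith⟩ H'

lemma psiM_mid (h : ℝ) (hh : 0 < h) (m k : ℕ) (hk : k ≤ m) (u : ℝ) (hu0 : 0 ≤ u) (hu2 : u ≤ 2) :
    psiM (((2 * (m + 1) : ℕ) : ℝ) * h) (2 * (m + 1)) (2 * k + 1) ((2 * k + u) * h)
      = -(u * (u - 2)) := by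
  rw [psiM_scaled h hh _ (by omega)]
  rw [if_neg (by omega), if_neg (by omega), if_pos (by omega)]
  push_cast
  rw [if_pos ⟨by linarith, by linarith⟩]
  ring

lemma psiM_right (h : ℝ) (hh : 0 < h) (m k : ℕ) (hk : k ≤ m) (u : ℝ) (hu0 : 0 ≤ u) (hu2 : u ≤ 2) :
    psiM (((2 * (m + 1) : ℕ) : ℝ) * h) (2 * (m + 1)) (2 * k + 2) ((2 * k + u) * h)
      = u * (u - 1) / 2 := by
  rw [psiM_scaled h hh _ (by omega)]
  rw [if_neg (by omega)]
  by_cases hkm : k = m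
  · subst hkm
    rw [if_pos (by omega)]
    push_cast
    rw [if_pos ⟨by linarith, by linarith⟩]
    ring
  rw [if_neg (by omega), if_neg (by omega)]
  push_cast
  rw [if_pos ⟨by linarith, by linarith⟩]
  ring

lemma psiM_sum (h : ℝ) (hh : 0 < h) (m k : ℕ) (hk : k ≤ m) (u : ℝ) (hu0 : 0 ≤ u) (hu2 : u ≤ 2)
    (f : ℕ → ℝ) :
    ∑ i ∈ Finset.range (2 * (m + 1) + 1),
        f i * psiM (((2 * (m + 1) : ℕ) : ℝ) * h) (2 * (m + 1)) i ((2 * k + u) * h)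
      = f (2 * k) * ((u - 1) * (u - 2) / 2) + f (2 * k + 1) * (-(u * (u - 2)))
        + f (2 * k + 2) * (u * (u - 1) / 2) := by
  have hs : ({2 * k, 2 * k + 1, 2 * k + 2} : Finset ℕ) ⊆ Finset.range (2 * (m + 1) + 1) := by
    intro i hi
    simp only [Finset.mem_insert, Finset.mem_singleton] at hi
    rw [Finset.mem_range]
    omega
  rw [← Finset.sum_subset hs]
  · rw [Finset.sum_insert (by simp), Finset.sum_insert (by simp), Finset.sum_singleton,
      psiM_left h hh m k hk u hu0 hu2, psiM_mid h hh m k hk u hu0 hu2,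
      psiM_right h hh m k hk u hu0 hu2]
    ring
  · intro i _ hi
    simp only [Finset.mem_insert, Finset.mem_singleton, not_or] at hi
    rw [psiM_zero h hh m k i hk u hu0 hu2 hi.1 hi.2.1 hi.2.2, mul_zero]

lemma exists_cell (m : ℕ) (s : ℝ) (h0 : 0 ≤ s) (h1 : s ≤ 2 * (m + 1)) :
    ∃ k ≤ m, ∃ u : ℝ, 0 ≤ u ∧ u ≤ 2 ∧ s = 2 * k + u := by
  induction m with
  | zero => exact ⟨0, le_rfl, s, h0, by simpa using h1, by simp⟩
  | succ m ih =>
    rcases le_total s (2 * (m + 1)) with H | H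
    · obtain ⟨k, hk, r⟩ := ih H
      exact ⟨k, by omega, r⟩
    · push_cast at h1
      refine ⟨m + 1, le_rfl, s - 2 * (m + 1), by linarith, by linarith, ?_⟩
      push_cast; ring

lemma uniform_taylor (τ : ℝ) (hτ : 0 < τ) (y : ℝ → ℝ) (hy : ContDiffOn ℝ 3 y (Set.Icc 0 τ)) :
    ∃ M : ℝ, 0 ≤ M ∧ ∀ a b : ℝ, 0 ≤ a → a < b → b ≤ τ → ∃ p q r : ℝ, ∀ x ∈ Set.Icc a b,
      |y x - (p + q * (x - a) + r * (x - a) ^ 2)| ≤ M * (x - a) ^ 3 := by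
  have hU := uniqueDiffOn_Icc hτ
  have hc : ContinuousOn (iteratedDerivWithin 3 y (Set.Icc 0 τ)) (Set.Icc 0 τ) :=
    hy.continuousOn_iteratedDerivWithin (by norm_num) hU
  obtain ⟨M, hM⟩ := isCompact_Icc.exists_bound_of_continuousOn hc
  have hM0 : 0 ≤ M := (norm_nonneg _).trans (hM 0 ⟨le_rfl, hτ.le⟩)
  refine ⟨M, hM0, fun a b ha hab hb => ?_⟩
  have hsub : Set.Icc a b ⊆ Set.Icc 0 τ := Set.Icc_subset_Icc ha hb
  refine ⟨y a, iteratedDerivWithin 1 y (Set.Icc a b) a,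
    iteratedDerivWithin 2 y (Set.Icc a b) a / 2, fun x hx => ?_⟩
  have hf : ContDiffOn ℝ ((2 : ℕ) + 1) y (Set.Icc a b) := by
    have := hy.mono hsub
    norm_num
    exact this
  have T := taylor_mean_remainder_bound (n := 2) hab.le hf hx (C := M) (by
    intro z hz
    have : iteratedDerivWithin (2 + 1) y (Set.Icc a b) z
        = iteratedDerivWithin 3 y (Set.Icc 0 τ) z := by
      rw [iteratedDerivWithin_eq_iteratedFDerivWithin, iteratedDerivWithin_eq_iteratedFDerivWithin,
        iteratedFDerivWithin_subset hsub (uniqueDiffOn_Icc hab) hU (by exact_mod_cast hy) hz]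
    rw [this]
    exact hM z (hsub hz))
  have hxa : 0 ≤ x - a := by linarith [hx.1]
  have hp : 0 ≤ M * (x - a) ^ 3 := by positivity
  have E : taylorWithinEval y 2 (Set.Icc a b) a x = y a
      + iteratedDerivWithin 1 y (Set.Icc a b) a * (x - a)
      + iteratedDerivWithin 2 y (Set.Icc a b) a / 2 * (x - a) ^ 2 := by
    rw [taylorWithinEval_succ, taylorWithinEval_succ, taylor_within_zero_eval]
    simp [Nat.factorial]
    ring
  rw [E, Real.norm_eq_abs] at T
  refine T.trans ?_
  norm_num [Nat.factorial]
  linarith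

/-- if `y` is three times continuously differentiable on `[0, τ]`, then
the modified-hat-function interpolant approximates `y` with error `O(h³)`,
uniformly on `[0, τ]`. -/
theorem psiM_interpolation_error (τ : ℝ) (hτ : 0 < τ) (y : ℝ → ℝ)
    (hy : ContDiffOn ℝ 3 y (Set.Icc 0 τ)) :
    ∃ C : ℝ, 0 ≤ C ∧ ∀ n : ℕ, 2 ≤ n → Even n → ∀ t ∈ Set.Icc (0 : ℝ) τ,
      |y t - ∑ i ∈ Finset.range (n + 1), y ((i : ℝ) * (τ / n)) * psiM τ n i t|
        ≤ C * (τ / n) ^ 3 := by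
  obtain ⟨M, hM0, hM⟩ := uniform_taylor τ hτ y hy
  refine ⟨32 * M, by positivity, fun n hn hev t ht => ?_⟩
  obtain ⟨m, rfl⟩ : ∃ m, n = 2 * (m + 1) := by
    obtain ⟨r, hr⟩ := hev
    exact ⟨r - 1, by omega⟩
  obtain ⟨h, hh⟩ : ∃ h, h = τ / ((2 * (m + 1) : ℕ) : ℝ) := ⟨_, rfl⟩
  have hn0 : (0 : ℝ) < ((2 * (m + 1) : ℕ) : ℝ) := by positivity
  have hpos : 0 < h := by rw [hh]; positivity
  have hτh : τ = ((2 * (m + 1) : ℕ) : ℝ) * h := by rw [hh]; field_simp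
  rw [← hh]
  have hs1 : t / h ≤ 2 * (m + 1) := by
    rw [div_le_iff₀ hpos]
    have := ht.2
    rw [hτh] at this
    push_cast at this
    exact this
  obtain ⟨k, hk, u, hu0, hu2, hs⟩ := exists_cell m (t / h) (div_nonneg ht.1 hpos.le) hs1
  have hth : t = (2 * k + u) * h := by rw [← hs]; field_simp
  have hkm : (k : ℝ) ≤ m := by exact_mod_cast hk
  obtain ⟨p, q, r, H⟩ := hM (2 * k * h) ((2 * k + 2) * h) (by positivity) (by nlinarith) (by
    rw [hτh]; push_cast
    exact mul_le_mul_of_nonneg_right (by linarith) hpos.le)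
  have key : ∀ v : ℝ, 0 ≤ v → v ≤ 2 →
      |y ((2 * k + v) * h) - (p + q * (v * h) + r * (v * h) ^ 2)| ≤ 8 * M * h ^ 3 := by
    intro v hv0 hv2
    have := H ((2 * k + v) * h) ⟨by nlinarith, by nlinarith⟩
    have e : (2 * k + v) * h - 2 * k * h = v * h := by ring
    rw [e] at this
    refine this.trans ?_
    have h3 : (v * h) ^ 3 ≤ (2 * h) ^ 3 := by gcongr
    calc M * (v * h) ^ 3 ≤ M * (2 * h) ^ 3 := by gcongr
      _ = 8 * M * h ^ 3 := by ring
  have hsum := psiM_sum h hpos m k hk u hu0 hu2 (fun i => y ((i : ℝ) * h))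
  rw [← hτh, ← hth] at hsum
  rw [hsum]
  have kt := key u hu0 hu2
  have k0 := key 0 le_rfl (by norm_num)
  have k1 := key 1 (by norm_num) (by norm_num)
  have k2 := key 2 (by norm_num) le_rfl
  rw [← hth] at kt
  push_cast
  rw [add_zero] at k0
  have w0 : |(u - 1) * (u - 2) / 2| ≤ 1 := by rw [abs_le]; constructor <;> nlinarith
  have w1 : |(-(u * (u - 2)))| ≤ 1 := by rw [abs_le]; constructor <;> nlinarith [sq_nonneg (u - 1)]
  have w2 : |u * (u - 1) / 2| ≤ 1 := by rw [abs_le]; constructor <;> nlinarith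
  have comb : ∀ A w : ℝ, |A| ≤ 8 * M * h ^ 3 → |w| ≤ 1 → |A * w| ≤ 8 * M * h ^ 3 := by
    intro A w hA hw
    rw [abs_mul]
    calc |A| * |w| ≤ |A| * 1 := by gcongr
      _ ≤ _ := by linarith
  have c0 := abs_le.1 (comb _ _ k0 w0)
  have c1 := abs_le.1 (comb _ _ k1 w1)
  have c2 := abs_le.1 (comb _ _ k2 w2)
  have ct := abs_le.1 kt
  rw [abs_le]
  constructor <;> linarith [c0.1, c0.2, c1.1, c1.2, c2.1, c2.2, ct.1, ct.2]
end

section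
/- For any function y : ℝ → ℝ, any even index k with 0 ≤ k ≤ n − 2 and any t with kh ≤ t ≤ (k+2)h, the modified-hat-function interpolant satisfies Σ_{i=0}^{n} y(ih) ψ_i^M(t) = y(kh)·(t − (k+1)h)(t − (k+2)h)/(2h²) − y((k+1)h)·(t − kh)(t − (k+2)h)/h² + y((k+2)h)·(t − kh)(t − (k+1)h)/(2h²); that is, on each subinterval [kh, (k+2)h] with k even it equals the quadratic Lagrange interpolant of y through the three points (kh, y(kh)), ((k+1)h, y((k+1)h)) and ((k+2)h, y((k+2)h)). -/
theorem psiM_aux_left (τ h : ℝ) (n i k : ℕ) (hh : 0 < h) (e : τ / n = h) 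
    (hke : k % 2 = 0) (hk : k + 2 ≤ n) (t : ℝ)
    (ht₁ : (k : ℝ) * h ≤ t) (hi : i < k) : psiM τ n i t = 0 := by
  unfold psiM
  simp only [e]
  have key : ∀ m : ℕ, m ≤ k → (m : ℝ) * h ≤ t := fun m hm =>
    le_trans (mul_le_mul_of_nonneg_right (by exact_mod_cast hm) hh.le) ht₁
  split_ifs with h1 h2 h3 h4 h5 h6 h7 h8 h9
  · have := key 2 (by omega)
    push_cast at this
    have : t = 2 * h := le_antisymm h2.2 this
    rw [this]; ring
  · rfl
  · omega
  · omega
  · have := key (i + 1) (by omega)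
    push_cast at this
    have : t = (i + 1) * h := le_antisymm h6.2 this
    rw [this]; ring
  · rfl
  · have := key (i + 2) (by omega)
    push_cast at this
    nlinarith
  · have := key (i + 2) (by omega)
    push_cast at this
    have : t = (i + 2) * h := le_antisymm h8.2 this
    rw [this]; ring
  · rfl

theorem psiM_aux_right (τ h : ℝ) (n i k : ℕ) (hh : 0 < h) (e : τ / n = h) (e' : τ = n * h)
    (hne : n % 2 = 0) (hke : k % 2 = 0) (t : ℝ)
    (ht₂ : t ≤ ((k : ℝ) + 2) * h) (hi : k + 2 < i) : psiM τ n i t = 0 := by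
  unfold psiM
  simp only [e]
  have key : ∀ m : ℕ, k + 2 ≤ m → t ≤ (m : ℝ) * h := fun m hm =>
    le_trans ht₂ (mul_le_mul_of_nonneg_right (by exact_mod_cast hm) hh.le)
  split_ifs with h1 h2 h3 h4 h5 h6 h7 h8 h9
  · omega
  · rfl
  · have := key (n - 2) (by omega)
    rw [Nat.cast_sub (by omega)] at this
    push_cast at this
    have : t = τ - 2 * h := le_antisymm (by rw [e']; linarith) h4.1
    rw [this]; ring
  · rfl
  · have := key (i - 1) (by omega)
    rw [Nat.cast_sub (by omega)] at this
    push_cast at this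
    have : t = (i - 1) * h := le_antisymm this h6.1
    rw [this]; ring
  · rfl
  · have := key (i - 2) (by omega)
    rw [Nat.cast_sub (by omega)] at this
    push_cast at this
    have : t = (i - 2) * h := le_antisymm this h7.1
    rw [this]; ring
  · have := key (i - 2) (by omega)
    rw [Nat.cast_sub (by omega)] at this
    push_cast at this
    nlinarith
  · rfl

theorem psiM_aux_zero (τ h : ℝ) (n k : ℕ) (hh : 0 < h) (e : τ / n = h)
    (hke : k % 2 = 0) (hk : k + 2 ≤ n) (t : ℝ)
    (ht₁ : (k : ℝ) * h ≤ t) (ht₂ : t ≤ ((k : ℝ) + 2) * h) :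
    psiM τ n k t = (t - ((k : ℝ) + 1) * h) * (t - ((k : ℝ) + 2) * h) / (2 * h ^ 2) := by
  unfold psiM
  simp only [e]
  have hh' := hh.ne'
  split_ifs with h1 h2 h3 h4 h5 h6 h7 h8 h9
  · subst h1; push_cast; ring
  · subst h1; push_cast at *; exfalso; apply h2; constructor <;> linarith
  · omega
  · omega
  · omega
  · omega
  · have : t = k * h := le_antisymm h7.2 ht₁
    rw [this]; ring
  · ring
  · exact absurd ⟨ht₁, ht₂⟩ h8

theorem psiM_aux_one (τ h : ℝ) (n k : ℕ) (e : τ / n = h)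
    (hke : k % 2 = 0) (hk : k + 2 ≤ n) (t : ℝ)
    (ht₁ : (k : ℝ) * h ≤ t) (ht₂ : t ≤ ((k : ℝ) + 2) * h) :
    psiM τ n (k + 1) t = -((t - (k : ℝ) * h) * (t - ((k : ℝ) + 2) * h) / h ^ 2) := by
  unfold psiM
  simp only [e]
  rw [if_neg (by omega), if_neg (by omega), if_pos (by omega), if_pos]
  · push_cast; ring
  · push_cast; constructor <;> linarith

theorem psiM_aux_two (τ h : ℝ) (n k : ℕ) (e : τ / n = h) (e' : τ = n * h)
    (hke : k % 2 = 0) (t : ℝ)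
    (ht₁ : (k : ℝ) * h ≤ t) (ht₂ : t ≤ ((k : ℝ) + 2) * h) :
    psiM τ n (k + 2) t = (t - (k : ℝ) * h) * (t - ((k : ℝ) + 1) * h) / (2 * h ^ 2) := by
  unfold psiM
  simp only [e]
  rw [if_neg (by omega)]
  by_cases hn : k + 2 = n
  · have e2 : τ = (k + 2) * h := by rw [e', ← hn]; push_cast; ring
    rw [if_pos hn, if_pos (by rw [e2]; constructor <;> linarith), e2]
    ring
  · rw [if_neg hn, if_neg (by omega), if_pos]
    · push_cast; ring
    · push_cast; constructor <;> linarith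

/-- on each subinterval `[kh, (k+2)h]` with `k` even, `0 ≤ k ≤ n-2`, the
modified-hat-function interpolant equals the quadratic Lagrange interpolant of `y`
through `(kh, y(kh))`, `((k+1)h, y((k+1)h))` and `((k+2)h, y((k+2)h))`. -/
theorem psiM_interpolant_piecewise_quadratic (τ : ℝ) (hτ : 0 < τ) (n : ℕ) (hn : 2 ≤ n)
    (hne : Even n) (y : ℝ → ℝ) (k : ℕ) (hke : Even k) (hk : k ≤ n - 2) (t : ℝ)
    (ht₁ : (k : ℝ) * (τ / n) ≤ t) (ht₂ : t ≤ ((k : ℝ) + 2) * (τ / n)) :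
    ∑ i ∈ Finset.range (n + 1), y ((i : ℝ) * (τ / n)) * psiM τ n i t
      = y ((k : ℝ) * (τ / n)) *
          ((t - ((k : ℝ) + 1) * (τ / n)) * (t - ((k : ℝ) + 2) * (τ / n)) / (2 * (τ / n) ^ 2))
        - y (((k : ℝ) + 1) * (τ / n)) *
          ((t - (k : ℝ) * (τ / n)) * (t - ((k : ℝ) + 2) * (τ / n)) / (τ / n) ^ 2)
        + y (((k : ℝ) + 2) * (τ / n)) *
          ((t - (k : ℝ) * (τ / n)) * (t - ((k : ℝ) + 1) * (τ / n)) / (2 * (τ / n) ^ 2)) := by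
  have hn0 : (n : ℝ) ≠ 0 := by
    have : n ≠ 0 := by omega
    exact_mod_cast this
  have hh : 0 < τ / n := by positivity
  have e' : τ = n * (τ / n) := by field_simp
  have hke' := Nat.even_iff.1 hke
  have hne' := Nat.even_iff.1 hne
  have hk' : k + 2 ≤ n := by omega
  have hs : ({k, k + 1, k + 2} : Finset ℕ) ⊆ Finset.range (n + 1) := by
    intro i hi
    simp only [Finset.mem_insert, Finset.mem_singleton] at hi
    rw [Finset.mem_range]; omega
  rw [← Finset.sum_subset hs]
  · rw [Finset.sum_insert (by simp), Finset.sum_insert (by simp), Finset.sum_singleton,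
      psiM_aux_zero τ _ n k hh rfl hke' hk' t ht₁ ht₂,
      psiM_aux_one τ _ n k rfl hke' hk' t ht₁ ht₂,
      psiM_aux_two τ _ n k rfl e' hke' t ht₁ ht₂]
    push_cast
    ring
  · intro i _ hi
    simp only [Finset.mem_insert, Finset.mem_singleton] at hi
    rcases lt_or_ge i k with h | h
    · rw [psiM_aux_left τ _ n i k hh rfl hke' hk' t ht₁ h, mul_zero]
    · rw [psiM_aux_right τ _ n i k hh rfl e' hne' hke' t ht₂ (by omega), mul_zero]
end

section
/- Let α > 0. For every index i with 1 ≤ i ≤ n, the Riemann–Liouville fractional integral of order α of the generalized hat function ψ_i^G evaluated at its own grid point satisfies (I^α ψ_i^G)(ih) = h^α / Γ(α + 2). -/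
/-- The generalized hat functions on `[0, τ]` with `n` subintervals of length `h = τ/n`. -/
noncomputable def psiG (τ : ℝ) (n : ℕ) (i : ℕ) : ℝ → ℝ := fun t =>
  if i = 0 then
    if 0 ≤ t ∧ t ≤ τ / n then (τ / n - t) / (τ / n) else 0
  else if i = n then
    if τ - τ / n ≤ t ∧ t ≤ τ then (t - (τ - τ / n)) / (τ / n) else 0
  else
    if ((i : ℝ) - 1) * (τ / n) ≤ t ∧ t ≤ (i : ℝ) * (τ / n) then
      (t - ((i : ℝ) - 1) * (τ / n)) / (τ / n)
    else if (i : ℝ) * (τ / n) ≤ t ∧ t ≤ ((i : ℝ) + 1) * (τ / n) then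
      (((i : ℝ) + 1) * (τ / n) - t) / (τ / n)
    else 0

/-- The Riemann--Liouville fractional integral of order `α` of `y`. -/
noncomputable def rlInt (α : ℝ) (y : ℝ → ℝ) (t : ℝ) : ℝ :=
  (1 / Real.Gamma α) * ∫ s in (0 : ℝ)..t, (t - s) ^ (α - 1) * y s

theorem psiG_refl_aux (τ : ℝ) (hτ : 0 < τ) (n : ℕ) (hn : 2 ≤ n)
    (i : ℕ) (hi₁ : 1 ≤ i) (u : ℝ) (hu : 0 < u) :
    psiG τ n i ((i : ℝ) * (τ / n) - u) =
      if u ≤ τ / n then (τ / n - u) / (τ / n) else 0 := by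
  have hn0 : (0 : ℝ) < n := by
    have : 0 < n := by omega
    exact_mod_cast this
  have hnτ : (n : ℝ) * (τ / n) = τ := by field_simp
  unfold psiG
  rw [if_neg (by omega : ¬ i = 0)]
  by_cases hin : i = n
  · rw [if_pos hin, hin, hnτ]
    by_cases h : u ≤ τ / n
    · rw [if_pos h, if_pos ⟨by linarith, by linarith⟩]
      congr 1
      ring
    · rw [if_neg h, if_neg]
      rintro ⟨h1, h2⟩
      exact h (by linarith)
  · rw [if_neg hin]
    have key : ((i : ℝ) - 1) * (τ / n) = i * (τ / n) - τ / n := by ring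
    rw [key]
    by_cases h : u ≤ τ / n
    · rw [if_pos h, if_pos ⟨by linarith, by linarith⟩]
      congr 1
      ring
    · rw [if_neg h, if_neg, if_neg]
      · rintro ⟨h1, h2⟩
        linarith
      · rintro ⟨h1, h2⟩
        exact h (by linarith)

/-- for `1 ≤ i ≤ n`, the Riemann--Liouville fractional integral of order `α`
of `ψ_i^G` at its own grid point equals `h^α / Γ(α+2)`. -/
theorem rlInt_psiG_diag (τ : ℝ) (hτ : 0 < τ) (n : ℕ) (hn : 2 ≤ n) (α : ℝ) (hα : 0 < α)
    (i : ℕ) (hi₁ : 1 ≤ i) (hi₂ : i ≤ n) :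
    rlInt α (psiG τ n i) ((i : ℝ) * (τ / n)) = (τ / n) ^ α / Real.Gamma (α + 2) := by
  have hn0 : (0 : ℝ) < n := by
    have : 0 < n := by omega
    exact_mod_cast this
  have hψ := psiG_refl_aux τ hτ n hn i hi₁
  unfold rlInt
  have hh : 0 < τ / n := by positivity
  generalize psiG τ n i = ψ at hψ ⊢
  have hi : (1 : ℝ) ≤ i := by exact_mod_cast hi₁
  have hT : τ / n ≤ (i : ℝ) * (τ / n) := by nlinarith
  generalize (i : ℝ) * (τ / n) = T at hψ hT ⊢
  generalize τ / (n : ℝ) = h at hψ hh hT ⊢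
  have e1 : ∫ s in (0 : ℝ)..T, (T - s) ^ (α - 1) * ψ s
      = ∫ u in (0 : ℝ)..T, u ^ (α - 1) * ψ (T - u) := by
    have := intervalIntegral.integral_comp_sub_left (a := 0) (b := T)
      (fun u : ℝ => u ^ (α - 1) * ψ (T - u)) T
    simpa using this
  have c1 : Set.EqOn (fun u : ℝ => u ^ (α - 1) - u ^ α / h)
      (fun u : ℝ => u ^ (α - 1) * ψ (T - u)) (Set.uIoc 0 h) := by
    intro u hu
    rw [Set.uIoc_of_le hh.le] at hu
    have hp : u ^ α = u ^ (α - 1) * u := by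
      rw [← Real.rpow_add_one hu.1.ne']
      congr 1
      ring
    simp only [hψ u hu.1, if_pos hu.2, hp]
    field_simp
  have c2 : Set.EqOn (fun _ : ℝ => (0 : ℝ))
      (fun u : ℝ => u ^ (α - 1) * ψ (T - u)) (Set.uIoc h T) := by
    intro u hu
    rw [Set.uIoc_of_le hT] at hu
    simp only [hψ u (hh.trans hu.1), if_neg (not_le.mpr hu.1), mul_zero]
  have i1 : IntervalIntegrable (fun u : ℝ => u ^ (α - 1)) MeasureTheory.volume 0 h :=
    intervalIntegral.intervalIntegrable_rpow' (by linarith)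
  have i2 : IntervalIntegrable (fun u : ℝ => u ^ α / h) MeasureTheory.volume 0 h :=
    (intervalIntegral.intervalIntegrable_rpow' (by linarith)).div_const h
  have j1 := (i1.sub i2).congr c1
  have j2 := (intervalIntegrable_const (μ := MeasureTheory.volume) (c := (0 : ℝ))
    (a := h) (b := T)).congr c2
  have v1 : ∫ u in (0 : ℝ)..h, u ^ (α - 1) * ψ (T - u) = h ^ α / (α * (α + 1)) := by
    rw [← intervalIntegral.integral_congr_ae (MeasureTheory.ae_of_all _ c1), intervalIntegral.integral_sub i1 i2,
      intervalIntegral.integral_div, integral_rpow (Or.inl (by linarith)),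
      integral_rpow (Or.inl (by linarith)), sub_add_cancel, Real.zero_rpow hα.ne',
      Real.zero_rpow (by linarith), Real.rpow_add_one hh.ne']
    field_simp
    ring
  have v2 : ∫ u in h..T, u ^ (α - 1) * ψ (T - u) = 0 := by
    rw [← intervalIntegral.integral_congr_ae (MeasureTheory.ae_of_all _ c2)]
    simp
  have hG : Real.Gamma (α + 2) = (α + 1) * (α * Real.Gamma α) := by
    rw [show α + 2 = (α + 1) + 1 by ring, Real.Gamma_add_one (by linarith),
      Real.Gamma_add_one hα.ne']
  have hG0 : Real.Gamma α ≠ 0 := (Real.Gamma_pos_of_pos hα).ne'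
  rw [e1, ← intervalIntegral.integral_add_adjacent_intervals j1 j2, v1, v2, hG, add_zero]
  field_simp
end

section
/- Let α > 0. For every index j with 1 ≤ j ≤ n, the Riemann–Liouville fractional integral of order α of the first generalized hat function satisfies (I^α ψ_0^G)(jh) = (h^α / Γ(α + 2)) · ζ_j, where ζ_j = j^α(α − j + 1) + (j − 1)^{α+1}. -/
theorem integral_congr_on_uIoc {f g : ℝ → ℝ} {a b : ℝ} (h : Set.EqOn f g (Set.uIoc a b)) :
    ∫ x in a..b, f x = ∫ x in a..b, g x :=
  intervalIntegral.integral_congr_ae (Filter.Eventually.of_forall fun _ hx => h hx)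

/-- for `1 ≤ j ≤ n`, the Riemann--Liouville fractional integral of order `α`
of `ψ_0^G` at the grid point `jh` equals `(h^α / Γ(α+2)) · ζ_j`,
where `ζ_j = j^α (α - j + 1) + (j-1)^{α+1}`. -/
theorem rlInt_psiG_zero_row (τ : ℝ) (hτ : 0 < τ) (n : ℕ) (hn : 2 ≤ n) (α : ℝ) (hα : 0 < α)
    (j : ℕ) (hj₁ : 1 ≤ j) (hj₂ : j ≤ n) :
    rlInt α (psiG τ n 0) ((j : ℝ) * (τ / n))
      = (τ / n) ^ α / Real.Gamma (α + 2) *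
        ((j : ℝ) ^ α * (α - (j : ℝ) + 1) + ((j : ℝ) - 1) ^ (α + 1)) := by
  have hn0 : (0 : ℝ) < n := by
    have : 0 < n := by omega
    exact_mod_cast this
  have hh : 0 < τ / n := div_pos hτ hn0
  have hpsi : psiG τ n 0 = fun t =>
      if 0 ≤ t ∧ t ≤ τ / n then (τ / n - t) / (τ / n) else 0 := by
    funext t
    simp [psiG]
  rw [rlInt, hpsi]
  generalize τ / n = h at hh
  have hj : (1 : ℝ) ≤ j := by exact_mod_cast hj₁
  generalize (j : ℝ) = k at hj
  have hk : 0 ≤ k - 1 := by linarith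
  have hhT : h ≤ k * h := by nlinarith
  have e1 : Set.EqOn (fun s : ℝ => (k * h - s) ^ (α - 1) * ((h - s) / h))
      (fun s : ℝ => (k * h - s) ^ (α - 1) * (if 0 ≤ s ∧ s ≤ h then (h - s) / h else 0))
      (Set.uIoc 0 h) := by
    intro s hs
    rw [Set.uIoc_of_le hh.le] at hs
    simp [hs.1.le, hs.2]
  have e2 : Set.EqOn (fun s : ℝ => (0 : ℝ))
      (fun s : ℝ => (k * h - s) ^ (α - 1) * (if 0 ≤ s ∧ s ≤ h then (h - s) / h else 0))
      (Set.uIoc h (k * h)) := by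
    intro s hs
    rw [Set.uIoc_of_le hhT] at hs
    simp [not_le.mpr hs.1]
  have i0 : IntervalIntegrable (fun s : ℝ => (k * h - s) ^ (α - 1)) MeasureTheory.volume 0 h := by
    have := (intervalIntegral.intervalIntegrable_rpow' (r := α - 1) (a := k * h)
      (b := k * h - h) (by linarith)).comp_sub_left (k * h)
    simpa using this
  have i1 : IntervalIntegrable (fun s : ℝ => (k * h - s) ^ (α - 1) * ((h - s) / h))
      MeasureTheory.volume 0 h :=
    i0.mul_continuousOn (by fun_prop)
  have i2 : IntervalIntegrable (fun s : ℝ => (0 : ℝ)) MeasureTheory.volume h (k * h) := by simp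
  rw [← intervalIntegral.integral_add_adjacent_intervals (i1.congr e1) (i2.congr e2),
    ← integral_congr_on_uIoc e1, ← integral_congr_on_uIoc e2]
  have e3 : ∫ s in (0 : ℝ)..h, (k * h - s) ^ (α - 1) * ((h - s) / h)
      = ∫ u in (k * h - h)..(k * h), (u ^ α * (1 / h) + u ^ (α - 1) * (1 - k)) := by
    have := intervalIntegral.integral_comp_sub_left (a := 0) (b := h)
      (fun u : ℝ => u ^ (α - 1) * ((h - (k * h - u)) / h)) (k * h)
    simp only [sub_sub_cancel, sub_zero] at this
    rw [this]
    apply integral_congr_on_uIoc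
    intro u hu
    rw [Set.uIoc_of_le (by linarith)] at hu
    have hu0 : 0 < u := by nlinarith [hu.1]
    have : u ^ α = u ^ (α - 1) * u := by
      rw [← Real.rpow_add_one hu0.ne']; ring_nf
    simp only [this]
    field_simp
    ring
  rw [e3, intervalIntegral.integral_add
    ((intervalIntegral.intervalIntegrable_rpow' (by linarith)).mul_const _)
    ((intervalIntegral.intervalIntegrable_rpow' (by linarith)).mul_const _),
    intervalIntegral.integral_mul_const, intervalIntegral.integral_mul_const,
    integral_rpow (Or.inl (by linarith)), integral_rpow (Or.inl (by linarith))]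
  have hG : Real.Gamma (α + 2) = (α + 1) * (α * Real.Gamma α) := by
    rw [← Real.Gamma_add_one hα.ne', ← Real.Gamma_add_one (by linarith)]; ring_nf
  have hGp := Real.Gamma_pos_of_pos hα
  have a1 : k * h - h = (k - 1) * h := by ring
  have a2 : α - 1 + 1 = α := by ring
  have p1 : ∀ x : ℝ, 0 ≤ x → x ^ (α + 1) = x ^ α * x := fun x hx =>
    Real.rpow_add_one' hx (by linarith)
  rw [a1, a2, hG, p1 _ (by positivity), p1 _ (by positivity), p1 _ hk,
    Real.mul_rpow (by linarith) hh.le, Real.mul_rpow hk hh.le]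
  simp only [intervalIntegral.integral_zero]
  field_simp
  ring
end

section
/- Let α > 0. For all indices i, j with 1 ≤ i < j ≤ n, the Riemann–Liouville fractional integral of order α of the generalized hat function ψ_i^G satisfies (I^α ψ_i^G)(jh) = (h^α / Γ(α + 2)) · ϱ_{j−i}, where for k ≥ 1 one sets ϱ_k = (k+1)^{α+1} − 2k^{α+1} + (k−1)^{α+1}. -/
theorem ramp_aux (α : ℝ) (hα : 0 < α) (T : ℝ) :
    IntervalIntegrable (fun s : ℝ => (T - s) ^ (α - 1)) MeasureTheory.volume 0 T := by
  have h := (intervalIntegral.intervalIntegrable_rpow' (a := 0) (b := T) (r := α - 1)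
    (by linarith)).comp_sub_left T
  simpa using h.symm

theorem ramp_ii (α : ℝ) (hα : 0 < α) (T a : ℝ) :
    IntervalIntegrable (fun s : ℝ => (T - s) ^ (α - 1) * max (s - a) 0)
      MeasureTheory.volume 0 T := by
  apply (ramp_aux α hα T).mul_continuousOn
  fun_prop

theorem ramp_int (α : ℝ) (hα : 0 < α) (T a : ℝ) (ha : 0 ≤ a) (haT : a ≤ T) :
    ∫ s in (0 : ℝ)..T, (T - s) ^ (α - 1) * max (s - a) 0
      = (T - a) ^ (α + 1) / (α * (α + 1)) := by
  have hi := ramp_ii α hα T a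
  have h0T : (0 : ℝ) ≤ T := ha.trans haT
  have hm : a ∈ Set.uIcc 0 T := by
    rw [Set.uIcc_of_le h0T]; exact ⟨ha, haT⟩
  have h1 := hi.mono_set (Set.uIcc_subset_uIcc Set.left_mem_uIcc hm)
  have h2 := hi.mono_set (Set.uIcc_subset_uIcc hm Set.right_mem_uIcc)
  rw [← intervalIntegral.integral_add_adjacent_intervals h1 h2]
  have e1 : ∫ s in (0 : ℝ)..a, (T - s) ^ (α - 1) * max (s - a) 0 = ∫ s in (0 : ℝ)..a, (0 : ℝ) := by
    apply intervalIntegral.integral_congr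
    intro s hs
    rw [Set.uIcc_of_le ha] at hs
    simp [max_eq_right (sub_nonpos.2 hs.2)]
  have e2 : ∫ s in a..T, (T - s) ^ (α - 1) * max (s - a) 0
      = ∫ s in a..T, (fun x : ℝ => (T - a) * x ^ (α - 1) - x ^ α) (T - s) := by
    apply intervalIntegral.integral_congr
    intro s hs
    rw [Set.uIcc_of_le haT] at hs
    have := Real.rpow_add_one' (x := T - s) (y := α - 1) (by linarith [hs.2])
      (by linarith)
    rw [sub_add_cancel] at this
    simp only [max_eq_left (sub_nonneg.2 hs.1)]
    rw [this]; ring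
  rw [e1, e2, intervalIntegral.integral_comp_sub_left
    (fun x : ℝ => (T - a) * x ^ (α - 1) - x ^ α) T, intervalIntegral.integral_sub,
    intervalIntegral.integral_const_mul, integral_rpow (Or.inl (by linarith)),
    integral_rpow (Or.inl (by linarith))]
  · have := Real.rpow_add_one' (x := T - a) (y := α) (by linarith) (by linarith)
    simp only [sub_add_cancel, sub_self, intervalIntegral.integral_zero]
    rw [Real.zero_rpow hα.ne', Real.zero_rpow (by linarith), this]
    field_simp
    ring
  · exact (intervalIntegral.intervalIntegrable_rpow' (by linarith)).const_mul _
  · exact intervalIntegral.intervalIntegrable_rpow' (by linarith)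

/-- for `1 ≤ i < j ≤ n`, the Riemann--Liouville fractional integral of order
`α` of `ψ_i^G` at the grid point `jh` equals `(h^α / Γ(α+2)) · ϱ_{j-i}`,
where `ϱ_k = (k+1)^{α+1} - 2 k^{α+1} + (k-1)^{α+1}` for `k ≥ 1`. -/
theorem rlInt_psiG_upper (τ : ℝ) (hτ : 0 < τ) (n : ℕ) (hn : 2 ≤ n) (α : ℝ) (hα : 0 < α)
    (i j : ℕ) (hi : 1 ≤ i) (hij : i < j) (hj : j ≤ n) :
    rlInt α (psiG τ n i) ((j : ℝ) * (τ / n))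
      = (τ / n) ^ α / Real.Gamma (α + 2) *
        (((j - i : ℕ) + 1 : ℝ) ^ (α + 1) - 2 * ((j - i : ℕ) : ℝ) ^ (α + 1)
          + ((j - i : ℕ) - 1 : ℝ) ^ (α + 1)) := by
  have hn0 : (0 : ℝ) < n := by exact_mod_cast (by omega : 0 < n)
  have hh : 0 < τ / n := div_pos hτ hn0
  have hpsi : ∀ t, psiG τ n i t = (τ / n)⁻¹ * (max (t - ((i : ℝ) - 1) * (τ / n)) 0
      - 2 * max (t - (i : ℝ) * (τ / n)) 0 + max (t - ((i : ℝ) + 1) * (τ / n)) 0) := by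
    intro t
    unfold psiG
    rw [if_neg (by omega), if_neg (by omega)]
    generalize τ / n = h at hh
    have ea : ((i : ℝ) - 1) * h = i * h - h := by ring
    have ec : ((i : ℝ) + 1) * h = i * h + h := by ring
    rw [ea, ec]
    generalize (i : ℝ) * h = b
    rcases le_total t (b - h) with h1 | h1
    · rw [max_eq_right (by linarith), max_eq_right (by linarith), max_eq_right (by linarith)]
      split_ifs with h2 h3
      · have : t = b - h := le_antisymm h1 h2.1
        simp [this]
      · linarith [h3.1]
      · simp
    rcases le_total t b with h2 | h2
    · rw [max_eq_left (by linarith), max_eq_right (by linarith), max_eq_right (by linarith),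
        if_pos ⟨h1, h2⟩]
      field_simp
      ring
    rcases le_total t (b + h) with h3 | h3
    · rw [max_eq_left (by linarith), max_eq_left (by linarith), max_eq_right (by linarith)]
      split_ifs with h4 h5
      · have : t = b := le_antisymm h4.2 h2
        subst this
        field_simp
        ring
      · field_simp
        ring
      · exact absurd ⟨h2, h3⟩ h5
    · rw [max_eq_left (by linarith), max_eq_left (by linarith), max_eq_left (by linarith)]
      split_ifs with h4 h5
      · linarith [h4.2]
      · have : t = b + h := le_antisymm h5.2 h3
        subst this
        field_simp
        ring
      · field_simp
        ring
  have hk : ((j - i : ℕ) : ℝ) = (j : ℝ) - i := by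
    rw [Nat.cast_sub hij.le]
  have hi1 : (1 : ℝ) ≤ i := by exact_mod_cast hi
  have hij1 : (i : ℝ) + 1 ≤ j := by exact_mod_cast hij
  rw [hk]
  unfold rlInt
  simp only [hpsi]
  generalize τ / n = h at hh
  set T := (j : ℝ) * h with hT
  have I1 := ramp_ii α hα T (((i : ℝ) - 1) * h)
  have I2 := ramp_ii α hα T ((i : ℝ) * h)
  have I3 := ramp_ii α hα T (((i : ℝ) + 1) * h)
  have e : ∀ s : ℝ, (T - s) ^ (α - 1) * (h⁻¹ * (max (s - ((i : ℝ) - 1) * h) 0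
      - 2 * max (s - (i : ℝ) * h) 0 + max (s - ((i : ℝ) + 1) * h) 0))
      = h⁻¹ * ((T - s) ^ (α - 1) * max (s - ((i : ℝ) - 1) * h) 0
        - 2 * ((T - s) ^ (α - 1) * max (s - (i : ℝ) * h) 0)
        + (T - s) ^ (α - 1) * max (s - ((i : ℝ) + 1) * h) 0) := fun s => by ring
  simp only [e]
  rw [intervalIntegral.integral_const_mul,
    intervalIntegral.integral_add (I1.sub (I2.const_mul 2)) I3,
    intervalIntegral.integral_sub I1 (I2.const_mul 2), intervalIntegral.integral_const_mul,
    ramp_int α hα T _ (by nlinarith) (by rw [hT]; nlinarith),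
    ramp_int α hα T _ (by nlinarith) (by rw [hT]; nlinarith),
    ramp_int α hα T _ (by nlinarith) (by rw [hT]; nlinarith)]
  have t1 : T - ((i : ℝ) - 1) * h = ((j : ℝ) - i + 1) * h := by rw [hT]; ring
  have t2 : T - (i : ℝ) * h = ((j : ℝ) - i) * h := by rw [hT]; ring
  have t3 : T - ((i : ℝ) + 1) * h = ((j : ℝ) - i - 1) * h := by rw [hT]; ring
  rw [t1, t2, t3, Real.mul_rpow (by linarith) hh.le, Real.mul_rpow (by linarith) hh.le,
    Real.mul_rpow (by linarith) hh.le, Real.rpow_add_one hh.ne',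
    show α + 2 = (α + 1) + 1 by ring, Real.Gamma_add_one (by linarith : α + 1 ≠ 0),
    Real.Gamma_add_one hα.ne']
  have hG : Real.Gamma α ≠ 0 := (Real.Gamma_pos_of_pos hα).ne'
  have hα1 : α + 1 ≠ 0 := by linarith
  field_simp
end

section
/- Let α > 0. For every odd index i with 1 ≤ i ≤ n − 1 and every index j with i ≤ j ≤ n, the Riemann–Liouville fractional integral of order α of the modified hat function ψ_i^M satisfies (I^α ψ_i^M)(jh) = (h^α / (2Γ(α + 3))) · η_{j−i}, where η_0 = 4(1 + α) and, for k ≥ 1, η_k = 4[(k − 1)^{α+1}(k + 1 + α) − (k + 1)^{α+1}(k − 1 − α)]. -/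
lemma aux_poly_int (α : ℝ) (hα : 0 < α) (p q c0 c1 c2 : ℝ) (hp : 0 ≤ p) (hpq : p ≤ q) :
    ∫ u in p..q, u ^ (α - 1) * (c0 + c1 * u + c2 * u ^ 2)
      = c0 * ((q ^ α - p ^ α) / α) + c1 * ((q ^ (α + 1) - p ^ (α + 1)) / (α + 1))
        + c2 * ((q ^ (α + 2) - p ^ (α + 2)) / (α + 2)) := by
  have h1 : ∫ u in p..q, u ^ (α - 1) * (c0 + c1 * u + c2 * u ^ 2)
      = ∫ u in p..q, (c0 * u ^ (α - 1) + c1 * u ^ α + c2 * u ^ (α + 1)) := by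
    apply intervalIntegral.integral_congr_ae
    refine Filter.Eventually.of_forall fun u hu => ?_
    rw [Set.uIoc_of_le hpq] at hu
    have hu0 : 0 < u := lt_of_le_of_lt hp hu.1
    have e1 : u ^ α = u ^ (α - 1) * u := by
      rw [← Real.rpow_add_one hu0.ne']; congr 1; ring
    rw [Real.rpow_add_one hu0.ne', e1]; ring
  have i0 : IntervalIntegrable (fun u : ℝ => u ^ (α - 1)) MeasureTheory.volume p q :=
    intervalIntegral.intervalIntegrable_rpow' (by linarith)
  have i1 : IntervalIntegrable (fun u : ℝ => u ^ α) MeasureTheory.volume p q :=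
    intervalIntegral.intervalIntegrable_rpow' (by linarith)
  have i2 : IntervalIntegrable (fun u : ℝ => u ^ (α + 1)) MeasureTheory.volume p q :=
    intervalIntegral.intervalIntegrable_rpow' (by linarith)
  rw [h1, intervalIntegral.integral_add ((i0.const_mul c0).add (i1.const_mul c1))
    (i2.const_mul c2), intervalIntegral.integral_add (i0.const_mul c0) (i1.const_mul c1),
    intervalIntegral.integral_const_mul, intervalIntegral.integral_const_mul,
    intervalIntegral.integral_const_mul, integral_rpow (Or.inl (by linarith)),
    integral_rpow (Or.inl (by linarith)), integral_rpow (Or.inl (by linarith))]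
  have e1 : α - 1 + 1 = α := by ring
  have e2 : α + 1 + 1 = α + 2 := by ring
  rw [e1, e2]

/-- The integral reduced to the support of the hat function. -/
lemma aux_reduce (τ : ℝ) (hτ : 0 < τ) (n : ℕ) (hn : 2 ≤ n)
    (α : ℝ) (hα : 0 < α) (i j : ℕ) (hio : Odd i) (hi₁ : 1 ≤ i) (hi₂ : i ≤ n - 1)
    (h : ℝ) (hh : h = τ / n) (p q : ℝ) (hp : 0 ≤ p) (hpq : p ≤ q)
    (hq : q = ((j : ℝ) - i + 1) * h)
    (hpc : p = 0 ∧ j = i ∨ p = ((j : ℝ) - i - 1) * h) :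
    ∫ s in (0 : ℝ)..((j : ℝ) * h), ((j : ℝ) * h - s) ^ (α - 1) * psiM τ n i s
      = ∫ u in p..q, u ^ (α - 1) * ((1 - ((j : ℝ) - i) ^ 2) + (2 * ((j : ℝ) - i) / h) * u
          + (-(1 / h ^ 2)) * u ^ 2) := by
  have hn0 : (0 : ℝ) < n := by exact_mod_cast (by omega : 0 < n)
  have hpos : 0 < h := by rw [hh]; positivity
  have hi1 : (1 : ℝ) ≤ i := by exact_mod_cast hi₁
  have hodd : i % 2 = 1 := Nat.odd_iff.mp hio
  have hpsi : ∀ t, psiM τ n i t = if ((i : ℝ) - 1) * h ≤ t ∧ t ≤ ((i : ℝ) + 1) * h then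
      -(1 / h ^ 2) * (t - ((i : ℝ) - 1) * h) * (t - ((i : ℝ) + 1) * h) else 0 := by
    intro t
    unfold psiM
    rw [if_neg (by omega), if_neg (by omega), if_pos hodd, hh]
  set t : ℝ := (j : ℝ) * h with ht
  have hA : t - q = ((i : ℝ) - 1) * h := by rw [hq, ht]; ring
  have hA0 : 0 ≤ t - q := by rw [hA]; exact mul_nonneg (by linarith) hpos.le
  have hR := intervalIntegral.integral_comp_sub_left (a := t - q) (b := t - p)
    (fun u : ℝ => u ^ (α - 1) * ((1 - ((j : ℝ) - i) ^ 2) + (2 * ((j : ℝ) - i) / h) * u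
          + (-(1 / h ^ 2)) * u ^ 2)) t
  rw [sub_sub_cancel, sub_sub_cancel] at hR
  rw [← hR, intervalIntegral.integral_of_le (by linarith), intervalIntegral.integral_of_le (by linarith)]
  have hb : t - p ≤ ((i : ℝ) + 1) * h := by
    rcases hpc with ⟨h0, hji⟩ | h0
    · rw [h0, ht, hji]; nlinarith
    · rw [h0, ht]; apply le_of_eq; ring
  rw [MeasureTheory.setIntegral_eq_of_subset_of_forall_sdiff_eq_zero (s := Set.Ioc (t - q) (t - p))
    measurableSet_Ioc]
  · apply MeasureTheory.setIntegral_congr_fun measurableSet_Ioc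
    intro s hs
    simp only
    rw [hpsi, if_pos ⟨by linarith [hs.1], by linarith [hs.2]⟩]
    congr 1
    rw [ht]
    field_simp
    ring
  · exact Set.Ioc_subset_Ioc hA0 (by linarith)
  · rintro s ⟨hs, hs'⟩
    rw [hpsi]
    split_ifs with hc
    · rcases hc.1.eq_or_lt with e | hlt
      · rw [← e]; ring
      · have h2 : t - p < s := by
          by_contra hcon
          exact hs' ⟨by linarith, by linarith⟩
        rcases hpc with ⟨h0, hji⟩ | h0
        · linarith [hs.2]
        · have : t - p = ((i : ℝ) + 1) * h := by rw [h0, ht]; ring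
          linarith [hc.2]
    · simp

lemma aux_gamma (α : ℝ) (hα : 0 < α) :
    Real.Gamma (α + 3) = (α + 2) * (α + 1) * α * Real.Gamma α := by
  have e3 : α + 3 = (α + 2) + 1 := by ring
  have e2 : α + 2 = (α + 1) + 1 := by ring
  rw [e3, Real.Gamma_add_one (by linarith), e2, Real.Gamma_add_one (by linarith),
    Real.Gamma_add_one hα.ne']
  ring

/-- splitting of powers of a scaled argument -/
lemma aux_pow (α : ℝ) (hα : 0 < α) (x h : ℝ) (hx : 0 ≤ x) (hh : 0 < h) :
    (x * h) ^ α = x ^ α * h ^ α ∧ (x * h) ^ (α + 1) = x ^ α * x * (h ^ α * h) ∧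
    (x * h) ^ (α + 2) = x ^ α * x ^ 2 * (h ^ α * h ^ 2) ∧ x ^ (α + 1) = x ^ α * x := by
  have a1 : ∀ y : ℝ, 0 ≤ y → y ^ (α + 1) = y ^ α * y := fun y hy => by
    rw [Real.rpow_add' hy (by linarith), Real.rpow_one]
  have a2 : ∀ y : ℝ, 0 ≤ y → y ^ (α + 2) = y ^ α * y ^ 2 := fun y hy => by
    rw [Real.rpow_add' hy (by linarith), Real.rpow_two]
  have hm := Real.mul_rpow hx hh.le (z := α)
  have hxh : 0 ≤ x * h := by positivity
  refine ⟨hm, ?_, ?_, a1 x hx⟩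
  · rw [a1 _ hxh, hm]; ring
  · rw [a2 _ hxh, hm]; ring

/-- for odd `i` with `1 ≤ i ≤ n-1` and `i ≤ j ≤ n`, the Riemann--Liouville
fractional integral of order `α` of `ψ_i^M` at the grid point `jh` equals
`(h^α / (2Γ(α+3))) · η_{j-i}`, where `η_0 = 4(1+α)` and, for `k ≥ 1`,
`η_k = 4[(k-1)^{α+1}(k+1+α) - (k+1)^{α+1}(k-1-α)]`. -/
theorem rlInt_psiM_odd (τ : ℝ) (hτ : 0 < τ) (n : ℕ) (hn : 2 ≤ n) (hne : Even n)
    (α : ℝ) (hα : 0 < α) (i j : ℕ) (hio : Odd i) (hi₁ : 1 ≤ i) (hi₂ : i ≤ n - 1)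
    (hij : i ≤ j) (hj : j ≤ n) :
    rlInt α (psiM τ n i) ((j : ℝ) * (τ / n))
      = (τ / n) ^ α / (2 * Real.Gamma (α + 3)) *
        (if j = i then 4 * (1 + α)
         else 4 * ((((j - i : ℕ) : ℝ) - 1) ^ (α + 1) * (((j - i : ℕ) : ℝ) + 1 + α)
            - (((j - i : ℕ) : ℝ) + 1) ^ (α + 1) * (((j - i : ℕ) : ℝ) - 1 - α))) := by
  have hn0 : (0 : ℝ) < n := by exact_mod_cast (by omega : 0 < n)
  obtain ⟨h, hh⟩ : ∃ h : ℝ, h = τ / n := ⟨_, rfl⟩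
  have hpos : 0 < h := by rw [hh]; positivity
  have hG := Real.Gamma_pos_of_pos hα
  unfold rlInt
  rw [← hh, aux_gamma α hα]
  have hα1 : α + 1 ≠ 0 := by linarith
  have hα2 : α + 2 ≠ 0 := by linarith
  by_cases hji : j = i
  · rw [if_pos hji, aux_reduce τ hτ n hn α hα i j hio hi₁ hi₂ h hh 0 h le_rfl hpos.le
      (by rw [hji]; ring) (Or.inl ⟨rfl, hji⟩), aux_poly_int α hα _ _ _ _ _ le_rfl hpos.le,
      Real.zero_rpow hα.ne', Real.zero_rpow hα1, Real.zero_rpow hα2, hji]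
    obtain ⟨-, b1, b2, -⟩ := aux_pow α hα 1 h zero_le_one hpos
    rw [one_mul, Real.one_rpow] at b1 b2
    rw [b1, b2]
    field_simp
    ring
  · rw [if_neg hji, Nat.cast_sub hij]
    have hk : (1 : ℝ) ≤ (j : ℝ) - i := by
      have : (i : ℝ) + 1 ≤ j := by exact_mod_cast (by omega : i + 1 ≤ j)
      linarith
    have hp0 : 0 ≤ ((j : ℝ) - i - 1) * h := mul_nonneg (by linarith) hpos.le
    have hpq : ((j : ℝ) - i - 1) * h ≤ ((j : ℝ) - i + 1) * h := by nlinarith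
    rw [aux_reduce τ hτ n hn α hα i j hio hi₁ hi₂ h hh _ _ hp0 hpq rfl (Or.inr rfl),
      aux_poly_int α hα _ _ _ _ _ hp0 hpq]
    generalize (j : ℝ) - i = k at *
    obtain ⟨a0, a1, a2, a3⟩ := aux_pow α hα (k - 1) h (by linarith) hpos
    obtain ⟨b0, b1, b2, b3⟩ := aux_pow α hα (k + 1) h (by linarith) hpos
    rw [a0, a1, a2, a3, b0, b1, b2, b3]
    generalize (k - 1) ^ α = X
    generalize (k + 1) ^ α = Y
    field_simp
    ring
end

section
/- Let α > 0. For every even index i with 2 ≤ i ≤ n and every index j with i − 1 ≤ j ≤ n, the Riemann–Liouville fractional integral of order α of the modified hat function ψ_i^M satisfies (I^α ψ_i^M)(jh) = (h^α / (2Γ(α + 3))) · ξ_{j−i}, where ξ_{−1} = −α, ξ_0 = 2^{α+1}(2 − α), ξ_1 = 3^{α+1}(4 − α) − 6(2 + α), and, for k ≥ 2, ξ_k = (k + 2)^{α+1}(2k + 2 − α) − 6k^{α+1}(2 + α) − (k − 2)^{α+1}(2k − 2 + α). -/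
open MeasureTheory Set in
/-- Interval integrability together with the value of the integral. -/
def HasIntv (f : ℝ → ℝ) (a b I : ℝ) : Prop :=
  IntervalIntegrable f volume a b ∧ ∫ s in a..b, f s = I

theorem HasIntv.trans {f : ℝ → ℝ} {a b c I J : ℝ} (h₁ : HasIntv f a b I) (h₂ : HasIntv f b c J) :
    HasIntv f a c (I + J) := by
  refine ⟨h₁.1.trans h₂.1, ?_⟩
  rw [← intervalIntegral.integral_add_adjacent_intervals h₁.1 h₂.1, h₁.2, h₂.2]

theorem HasIntv.congr {f g : ℝ → ℝ} {a b I : ℝ} (h₁ : HasIntv f a b I)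
    (h : Set.EqOn f g (Set.uIoo a b)) : HasIntv g a b I :=
  ⟨h₁.1.congr_uIoo h, by rw [← intervalIntegral.integral_congr_uIoo h, h₁.2]⟩

theorem hasIntv_zero {f : ℝ → ℝ} {a b : ℝ} (hab : a ≤ b) (h : ∀ s, a < s → s < b → f s = 0) :
    HasIntv f a b 0 := by
  have h0 : HasIntv (fun _ => (0 : ℝ)) a b 0 := ⟨by simp, by simp⟩
  refine h0.congr ?_
  intro s hs
  rw [Set.uIoo_of_le hab] at hs
  exact (h s hs.1 hs.2).symm

/-- The antiderivative bracket. -/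
noncomputable def GG (α A B u : ℝ) : ℝ :=
  u ^ α * (A * B / α - (A + B) * u / (α + 1) + u ^ 2 / (α + 2))

theorem hasIntv_base {α h : ℝ} (hα : 0 < α) (hh : 0 < h) (A B : ℝ) {a b : ℝ}
    (ha : 0 ≤ a) (hab : a ≤ b) :
    HasIntv (fun v => v ^ (α - 1) * ((1 / (2 * h ^ 2)) * (v - A * h) * (v - B * h)))
      (a * h) (b * h) (h ^ α / 2 * (GG α A B b - GG α A B a)) := by
  have hb : 0 ≤ b := ha.trans hab
  have i1 : IntervalIntegrable (fun v : ℝ => v ^ (α - 1)) MeasureTheory.volume (a * h) (b * h) :=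
    intervalIntegral.intervalIntegrable_rpow' (by linarith)
  have i2 : IntervalIntegrable (fun v : ℝ => v ^ α) MeasureTheory.volume (a * h) (b * h) :=
    intervalIntegral.intervalIntegrable_rpow' (by linarith)
  have i3 : IntervalIntegrable (fun v : ℝ => v ^ (α + 1)) MeasureTheory.volume (a * h) (b * h) :=
    intervalIntegral.intervalIntegrable_rpow' (by linarith)
  have j1 := i1.const_mul (A * B / 2)
  have j2 := i2.const_mul ((A + B) / (2 * h))
  have j3 := i3.const_mul (1 / (2 * h ^ 2))
  have key : HasIntv (fun v : ℝ => A * B / 2 * v ^ (α - 1) - (A + B) / (2 * h) * v ^ α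
      + 1 / (2 * h ^ 2) * v ^ (α + 1)) (a * h) (b * h)
      (h ^ α / 2 * (GG α A B b - GG α A B a)) := by
    refine ⟨(j1.sub j2).add j3, ?_⟩
    rw [intervalIntegral.integral_add (j1.sub j2) j3, intervalIntegral.integral_sub j1 j2,
      intervalIntegral.integral_const_mul, intervalIntegral.integral_const_mul,
      intervalIntegral.integral_const_mul, integral_rpow (Or.inl (by linarith)),
      integral_rpow (Or.inl (by linarith)), integral_rpow (Or.inl (by linarith))]
    have e : ∀ u : ℝ, 0 ≤ u → (u * h) ^ (α - 1 + 1) = u ^ α * h ^ α ∧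
        (u * h) ^ (α + 1) = u ^ α * h ^ α * (u * h) ∧
        (u * h) ^ (α + 1 + 1) = u ^ α * h ^ α * (u * h) ^ 2 := by
      intro u hu
      have h1 : (u * h) ^ α = u ^ α * h ^ α := Real.mul_rpow hu hh.le
      have hp : 0 ≤ u * h := by positivity
      refine ⟨by rw [sub_add_cancel, h1], ?_, ?_⟩
      · rw [Real.rpow_add_one' hp (by linarith), h1]
      · rw [Real.rpow_add_one' hp (by linarith), Real.rpow_add_one' hp (by linarith), h1]; ring
    obtain ⟨a1, a2, a3⟩ := e a ha
    obtain ⟨b1, b2, b3⟩ := e b hb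
    rw [a1, a2, a3, b1, b2, b3]
    have n1 : α + 1 ≠ 0 := by linarith
    have n2 : α + 2 ≠ 0 := by linarith
    have n3 : α + 1 + 1 = α + 2 := by ring
    have n4 : α - 1 + 1 = α := by ring
    rw [n3, n4]
    unfold GG
    field_simp
    ring
  refine key.congr ?_
  intro v hv
  rw [Set.uIoo_of_le (by gcongr)] at hv
  have hv0 : 0 < v := lt_of_le_of_lt (by positivity) hv.1
  have e1 : v ^ α = v ^ (α - 1) * v := by
    rw [← Real.rpow_add_one hv0.ne', sub_add_cancel]
  have e2 : v ^ (α + 1) = v ^ (α - 1) * v * v := by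
    rw [Real.rpow_add_one hv0.ne', e1]
  simp only [e1, e2]
  field_simp
  ring

theorem hasIntv_piece {α h : ℝ} (hα : 0 < α) (hh : 0 < h) {y : ℝ → ℝ} (A B J p q : ℝ)
    (hpq : p ≤ q) (hq : q ≤ J)
    (hy : ∀ s, p * h < s → s < q * h → y s = (1 / (2 * h ^ 2)) * (s - A * h) * (s - B * h)) :
    HasIntv (fun s => (J * h - s) ^ (α - 1) * y s) (p * h) (q * h)
      (h ^ α / 2 * (GG α (J - A) (J - B) (J - p) - GG α (J - A) (J - B) (J - q))) := by
  have hb := hasIntv_base hα hh (J - A) (J - B) (a := J - q) (b := J - p) (by linarith)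
    (by linarith)
  have hc : HasIntv (fun s => (J * h - s) ^ (α - 1) * ((1 / (2 * h ^ 2)) *
      ((J * h - s) - (J - A) * h) * ((J * h - s) - (J - B) * h))) (p * h) (q * h)
      (h ^ α / 2 * (GG α (J - A) (J - B) (J - p) - GG α (J - A) (J - B) (J - q))) := by
    have ep : p * h = J * h - (J - p) * h := by ring
    have eq : q * h = J * h - (J - q) * h := by ring
    constructor
    · have := (hb.1.comp_sub_left (J * h)).symm
      rwa [← ep, ← eq] at this
    · rw [← hb.2, intervalIntegral.integral_comp_sub_left (fun v => v ^ (α - 1) *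
        ((1 / (2 * h ^ 2)) * (v - (J - A) * h) * (v - (J - B) * h))) (J * h)]
      congr 1 <;> ring
  refine hc.congr ?_
  intro s hs
  rw [Set.uIoo_of_le (by gcongr)] at hs
  simp only [hy s hs.1 hs.2]
  ring

/-- for even `i` with `2 ≤ i ≤ n` and `i - 1 ≤ j ≤ n`, the Riemann--Liouville
fractional integral of order `α` of `ψ_i^M` at the grid point `jh` equals
`(h^α / (2Γ(α+3))) · ξ_{j-i}`, where `ξ_{-1} = -α`, `ξ_0 = 2^{α+1}(2-α)`,
`ξ_1 = 3^{α+1}(4-α) - 6(2+α)` and, for `k ≥ 2`,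
`ξ_k = (k+2)^{α+1}(2k+2-α) - 6 k^{α+1}(2+α) - (k-2)^{α+1}(2k-2+α)`. -/
theorem rlInt_psiM_even (τ : ℝ) (hτ : 0 < τ) (n : ℕ) (hn : 2 ≤ n) (hne : Even n)
    (α : ℝ) (hα : 0 < α) (i j : ℕ) (hie : Even i) (hi₁ : 2 ≤ i) (hi₂ : i ≤ n)
    (hij : i - 1 ≤ j) (hj : j ≤ n) :
    rlInt α (psiM τ n i) ((j : ℝ) * (τ / n))
      = (τ / n) ^ α / (2 * Real.Gamma (α + 3)) *
        (if j = i - 1 then -α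
         else if j = i then (2 : ℝ) ^ (α + 1) * (2 - α)
         else if j = i + 1 then (3 : ℝ) ^ (α + 1) * (4 - α) - 6 * (2 + α)
         else (((j - i : ℕ) : ℝ) + 2) ^ (α + 1) * (2 * ((j - i : ℕ) : ℝ) + 2 - α)
            - 6 * ((j - i : ℕ) : ℝ) ^ (α + 1) * (2 + α)
            - (((j - i : ℕ) : ℝ) - 2) ^ (α + 1) * (2 * ((j - i : ℕ) : ℝ) - 2 + α)) := by
  have hnpos : (0 : ℝ) < n := by exact_mod_cast (by omega : 0 < n)
  obtain ⟨h, hh⟩ : ∃ h, h = τ / n := ⟨_, rfl⟩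
  have hpos : 0 < h := by rw [hh]; positivity
  have hτh : τ = n * h := by rw [hh]; field_simp
  have hi0 : i ≠ 0 := by omega
  have hio : ¬ (i % 2 = 1) := by rcases hie with ⟨m, rfl⟩; omega
  have hi2r : (2 : ℝ) ≤ i := by exact_mod_cast hi₁
  -- values of the hat function
  have vleft : ∀ s, ((i : ℝ) - 2) * h < s → s < (i : ℝ) * h →
      psiM τ n i s = (1 / (2 * h ^ 2)) * (s - ((i : ℝ) - 1) * h) * (s - ((i : ℝ) - 2) * h) := by
    intro s h1 h2
    unfold psiM
    rw [← hh]
    by_cases hin : i = n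
    · subst hin
      rw [if_neg hi0, if_pos rfl, if_pos ⟨by rw [hτh]; linarith, by rw [hτh]; linarith⟩, hτh]
      ring
    · rw [if_neg hi0, if_neg hin, if_neg hio, if_pos ⟨h1.le, h2.le⟩]
  have vzero : ∀ s, s < ((i : ℝ) - 2) * h → psiM τ n i s = 0 := by
    intro s h1
    unfold psiM
    rw [← hh]
    by_cases hin : i = n
    · subst hin
      rw [if_neg hi0, if_pos rfl, if_neg]
      rintro ⟨h2, -⟩
      rw [hτh] at h2; linarith
    · rw [if_neg hi0, if_neg hin, if_neg hio, if_neg, if_neg]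
      · rintro ⟨h2, -⟩; linarith
      · rintro ⟨h2, -⟩; linarith
  have vright : i < n → ∀ s, (i : ℝ) * h < s → s < ((i : ℝ) + 2) * h →
      psiM τ n i s = (1 / (2 * h ^ 2)) * (s - ((i : ℝ) + 1) * h) * (s - ((i : ℝ) + 2) * h) := by
    intro hin s h1 h2
    unfold psiM
    rw [← hh, if_neg hi0, if_neg hin.ne, if_neg hio, if_neg, if_pos ⟨h1.le, h2.le⟩]
    rintro ⟨-, h3⟩; linarith
  have vzero' : i < n → ∀ s, ((i : ℝ) + 2) * h < s → psiM τ n i s = 0 := by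
    intro hin s h1
    unfold psiM
    rw [← hh, if_neg hi0, if_neg hin.ne, if_neg hio, if_neg, if_neg]
    · rintro ⟨-, h3⟩; linarith
    · rintro ⟨-, h3⟩; linarith
  have z : ∀ J : ℝ, HasIntv (fun s => (J * h - s) ^ (α - 1) * psiM τ n i s)
      0 (((i : ℝ) - 2) * h) 0 := by
    intro J
    refine hasIntv_zero (mul_nonneg (by linarith) hpos.le) ?_
    intro s _ h2
    rw [vzero s h2, mul_zero]
  have hΓ : Real.Gamma (α + 3) = (α + 2) * ((α + 1) * (α * Real.Gamma α)) := by
    rw [show α + 3 = (α + 2) + 1 by ring, Real.Gamma_add_one (by linarith),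
      show α + 2 = (α + 1) + 1 by ring, Real.Gamma_add_one (by linarith),
      Real.Gamma_add_one (by linarith)]
  have hΓ0 : Real.Gamma α ≠ 0 := (Real.Gamma_pos_of_pos hα).ne'
  have n1 : α + 1 ≠ 0 := by linarith
  have n2 : α + 2 ≠ 0 := by linarith
  have n0 : α ≠ 0 := hα.ne'
  have z0 : (0 : ℝ) ^ α = 0 := Real.zero_rpow n0
  unfold rlInt
  rw [← hh, hΓ]
  by_cases c1 : j = i - 1
  · rw [if_pos c1]
    have hJ : (j : ℝ) = (i : ℝ) - 1 := by
      have : j + 1 = i := by omega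
      rw [← this]; push_cast; ring
    have L := hasIntv_piece hα hpos ((i : ℝ) - 1) ((i : ℝ) - 2) (j : ℝ) ((i : ℝ) - 2) (j : ℝ)
      (by linarith) le_rfl (y := psiM τ n i)
      (fun s h1 h2 => vleft s h1 (h2.trans (by rw [hJ]; nlinarith)))
    have T := ((z (j : ℝ)).trans L).2
    rw [T, hJ]
    ring_nf
    unfold GG
    simp only [z0, Real.one_rpow]
    field_simp
    ring
  rw [if_neg c1]
  by_cases c2 : j = i
  · rw [if_pos c2]
    subst c2
    have L := hasIntv_piece hα hpos ((j : ℝ) - 1) ((j : ℝ) - 2) (j : ℝ) ((j : ℝ) - 2) (j : ℝ)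
      (by linarith) le_rfl (y := psiM τ n j) vleft
    have T := ((z (j : ℝ)).trans L).2
    rw [T, Real.rpow_add_one two_ne_zero]
    have e1 : (j : ℝ) - (j - 1) = 1 := by ring
    have e2 : (j : ℝ) - (j - 2) = 2 := by ring
    rw [e1, e2, sub_self]
    unfold GG
    rw [z0]
    field_simp
    ring
  rw [if_neg c2]
  have hin : i < n := by omega
  by_cases c3 : j = i + 1
  · rw [if_pos c3]
    have hJ : (j : ℝ) = (i : ℝ) + 1 := by rw [c3]; push_cast; ring
    have L := hasIntv_piece hα hpos ((i : ℝ) - 1) ((i : ℝ) - 2) (j : ℝ) ((i : ℝ) - 2) (i : ℝ)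
      (by linarith) (by linarith) (y := psiM τ n i) vleft
    have R := hasIntv_piece hα hpos ((i : ℝ) + 1) ((i : ℝ) + 2) (j : ℝ) (i : ℝ) (j : ℝ)
      (by linarith) le_rfl (y := psiM τ n i)
      (fun s h1 h2 => vright hin s h1 (h2.trans (by rw [hJ]; nlinarith)))
    have T := (((z (j : ℝ)).trans L).trans R).2
    rw [T, hJ, Real.rpow_add_one three_ne_zero]
    have e1 : (i : ℝ) + 1 - (i - 1) = 2 := by ring
    have e2 : (i : ℝ) + 1 - (i - 2) = 3 := by ring
    have e3 : (i : ℝ) + 1 - i = 1 := by ring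
    have e4 : (i : ℝ) + 1 - (i + 2) = -1 := by ring
    rw [e1, e2, e3, e4, sub_self]
    unfold GG
    rw [z0, Real.one_rpow]
    field_simp
    ring
  rw [if_neg c3]
  obtain ⟨k, rfl⟩ : ∃ k, j = i + k := ⟨j - i, by omega⟩
  have hk : (2 : ℝ) ≤ k := by exact_mod_cast (by omega : 2 ≤ k)
  rw [Nat.add_sub_cancel_left]
  have L := hasIntv_piece hα hpos ((i : ℝ) - 1) ((i : ℝ) - 2) ((i : ℝ) + k) ((i : ℝ) - 2) (i : ℝ)
    (by linarith) (by linarith) (y := psiM τ n i) vleft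
  have R := hasIntv_piece hα hpos ((i : ℝ) + 1) ((i : ℝ) + 2) ((i : ℝ) + k) (i : ℝ) ((i : ℝ) + 2)
    (by linarith) (by linarith) (y := psiM τ n i) (vright hin)
  have Z : HasIntv (fun s => (((i : ℝ) + k) * h - s) ^ (α - 1) * psiM τ n i s)
      (((i : ℝ) + 2) * h) (((i : ℝ) + k) * h) 0 := by
    refine hasIntv_zero (by gcongr) ?_
    intro s h1 _
    rw [vzero' hin s h1, mul_zero]
  have T := ((((z ((i : ℝ) + k)).trans L).trans R).trans Z).2
  rw [Nat.cast_add, T, Real.rpow_add_one' (by linarith) n1, Real.rpow_add_one' (by linarith) n1,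
    Real.rpow_add_one' (by linarith) n1]
  have e1 : (i : ℝ) + k - (i - 1) = k + 1 := by ring
  have e2 : (i : ℝ) + k - (i - 2) = k + 2 := by ring
  have e3 : (i : ℝ) + k - i = k := by ring
  have e4 : (i : ℝ) + k - (i + 2) = k - 2 := by ring
  have e5 : (i : ℝ) + k - (i + 1) = k - 1 := by ring
  rw [e1, e2, e3, e4, e5]
  unfold GG
  generalize ((k : ℝ) + 2) ^ α = P
  generalize ((k : ℝ) - 2) ^ α = Q
  generalize (k : ℝ) ^ α = S
  field_simp
  ring
end

section
/- Let 0 < α < 1, let T > 0, and let y : ℝ → ℝ be continuously differentiable on [0, T]. Then for every t with 0 < t ≤ T, the Riemann–Liouville fractional integral of order α of the Caputo fractional derivative of order α of y satisfies (I^α (^C D^α y))(t) = y(t) − y(0). -/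
/-- The Caputo fractional derivative of order `α` (`0 < α < 1`) of `y`. -/
noncomputable def caputoDeriv (α : ℝ) (y : ℝ → ℝ) (t : ℝ) : ℝ :=
  (1 / Real.Gamma (1 - α)) * ∫ s in (0 : ℝ)..t, (t - s) ^ (-α) * deriv y s

open MeasureTheory Set

/-- The Beta integral on `[u, t]`. -/
theorem beta_kernel_integral (α : ℝ) (hα₁ : 0 < α) (hα₂ : α < 1) (u t : ℝ) (hut : u < t) :
    ∫ s in u..t, (t - s) ^ (α - 1) * (s - u) ^ (-α) = Real.Gamma α * Real.Gamma (1 - α) := by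
  have hc : 0 < t - u := sub_pos.2 hut
  have h1 := Complex.betaIntegral_scaled ((1 - α : ℝ) : ℂ) (α : ℂ) hc
  rw [Complex.betaIntegral_eq_Gamma_mul_div _ _ (by simpa using hα₂) (by simpa using hα₁)] at h1
  have e1 : ((1 - α : ℝ) : ℂ) + (α : ℂ) = 1 := by push_cast; ring
  rw [e1, sub_self, Complex.cpow_zero, Complex.Gamma_one, Complex.Gamma_ofReal,
    Complex.Gamma_ofReal] at h1
  have h2 : ∫ x in (0 : ℝ)..(t - u), (x : ℂ) ^ (((1 - α : ℝ) : ℂ) - 1) *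
      (((t - u : ℝ) : ℂ) - x) ^ ((α : ℂ) - 1)
      = ((∫ x in (0 : ℝ)..(t - u), x ^ (-α) * (t - u - x) ^ (α - 1) : ℝ) : ℂ) := by
    rw [← intervalIntegral.integral_ofReal]
    apply intervalIntegral.integral_congr
    intro x hx
    rw [uIcc_of_le hc.le] at hx
    simp only
    rw [Complex.ofReal_mul, Complex.ofReal_cpow hx.1, Complex.ofReal_cpow (by linarith [hx.2])]
    push_cast
    congr 2
    ring
  rw [h2] at h1
  have h3 : ∫ x in (0 : ℝ)..(t - u), x ^ (-α) * (t - u - x) ^ (α - 1)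
      = Real.Gamma (1 - α) * Real.Gamma α := by
    have := h1
    rw [one_mul, div_one] at this
    exact_mod_cast this
  have h4 := intervalIntegral.integral_comp_sub_right (a := u) (b := t)
    (fun x : ℝ => x ^ (-α) * (t - u - x) ^ (α - 1)) u
  rw [sub_self, h3] at h4
  rw [mul_comm, ← h4]
  apply intervalIntegral.integral_congr
  intro x _
  simp only
  rw [mul_comm, show t - u - (x - u) = t - x by ring]

theorem beta_kernel_integrable (α : ℝ) (hα₁ : 0 < α) (hα₂ : α < 1) (u t : ℝ) (hut : u < t) :
    IntegrableOn (fun s => (t - s) ^ (α - 1) * (s - u) ^ (-α)) (Ioc u t) := by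
  have h := beta_kernel_integral α hα₁ hα₂ u t hut
  by_contra hn
  rw [intervalIntegral.integral_of_le hut.le, integral_undef hn] at h
  have := mul_pos (Real.Gamma_pos_of_pos hα₁) (Real.Gamma_pos_of_pos (sub_pos.2 hα₂))
  linarith

/-- The kernel on the triangle. -/
noncomputable def triKernel (α t : ℝ) (s u : ℝ) : ℝ :=
  if u < s then (t - s) ^ (α - 1) * (s - u) ^ (-α) else 0

theorem triKernel_measurable (α t : ℝ) :
    Measurable (fun p : ℝ × ℝ => triKernel α t p.1 p.2) := by
  unfold triKernel
  apply Measurable.ite (measurableSet_lt measurable_snd measurable_fst)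
  · fun_prop
  · fun_prop

theorem triKernel_eq_indicator (α t u : ℝ) :
    (fun s => triKernel α t s u) =
      (Ioi u).indicator (fun s => (t - s) ^ (α - 1) * (s - u) ^ (-α)) := by
  ext s
  simp [triKernel, indicator]

theorem triKernel_integrable (α : ℝ) (hα₁ : 0 < α) (hα₂ : α < 1) (u t : ℝ) (hu : 0 < u)
    (hut : u < t) : Integrable (fun s => triKernel α t s u) (volume.restrict (Ioc 0 t)) := by
  rw [triKernel_eq_indicator, integrable_indicator_iff measurableSet_Ioi, IntegrableOn,
    Measure.restrict_restrict measurableSet_Ioi]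
  refine (beta_kernel_integrable α hα₁ hα₂ u t hut).mono_set ?_
  rintro x ⟨h1, h2⟩
  exact ⟨h1, h2.2⟩

theorem triKernel_integral (α : ℝ) (hα₁ : 0 < α) (hα₂ : α < 1) (u t : ℝ) (hu : 0 < u)
    (hut : u < t) : ∫ s in Ioc 0 t, triKernel α t s u = Real.Gamma α * Real.Gamma (1 - α) := by
  rw [triKernel_eq_indicator, setIntegral_indicator measurableSet_Ioi,
    ← beta_kernel_integral α hα₁ hα₂ u t hut, intervalIntegral.integral_of_le hut.le]
  congr 2
  ext x
  simp only [mem_inter_iff, mem_Ioc, mem_Ioi]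
  constructor
  · rintro ⟨h1, h2⟩
    exact ⟨h2, h1.2⟩
  · rintro ⟨h1, h2⟩
    exact ⟨⟨hu.trans h1, h2⟩, h1⟩

theorem triKernel_nonneg (α t s u : ℝ) (hs : s ≤ t) : 0 ≤ triKernel α t s u := by
  unfold triKernel
  split_ifs with h
  · exact mul_nonneg (Real.rpow_nonneg (by linarith) _) (Real.rpow_nonneg (by linarith) _)
  · exact le_rfl

theorem triKernel_inner (α t s : ℝ) (hs : s ∈ Ioc 0 t) (g : ℝ → ℝ) :
    ∫ u in Ioc 0 t, triKernel α t s u * g u =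
      (t - s) ^ (α - 1) * ∫ u in (0 : ℝ)..s, (s - u) ^ (-α) * g u := by
  have e : (fun u => triKernel α t s u * g u) =
      (Iio s).indicator (fun u => (t - s) ^ (α - 1) * ((s - u) ^ (-α) * g u)) := by
    ext u
    by_cases h : u < s <;> simp [triKernel, indicator, h, mul_assoc]
  rw [e, setIntegral_indicator measurableSet_Iio, intervalIntegral.integral_of_le hs.1.le,
    integral_Ioc_eq_integral_Ioo, ← integral_const_mul]
  congr 2
  ext x
  simp only [mem_inter_iff, mem_Ioc, mem_Iio, mem_Ioo]
  constructor
  · rintro ⟨h1, h2⟩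
    exact ⟨h1.1, h2⟩
  · rintro ⟨h1, h2⟩
    exact ⟨⟨h1, h2.le.trans hs.2⟩, h2⟩

theorem ae_mem_Ioo (t : ℝ) : ∀ᵐ u ∂(volume.restrict (Ioc 0 t)), u ∈ Ioo 0 t := by
  rw [← restrict_Ioo_eq_restrict_Ioc]
  exact ae_restrict_mem measurableSet_Ioo

theorem fubini_kernel (α : ℝ) (hα₁ : 0 < α) (hα₂ : α < 1) (t : ℝ)
    (g : ℝ → ℝ) (hgm : Measurable g) (hg : IntegrableOn g (Ioc 0 t)) :
    ∫ s in Ioc 0 t, ∫ u in Ioc 0 t, triKernel α t s u * g u =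
      Real.Gamma α * Real.Gamma (1 - α) * ∫ u in Ioc 0 t, g u := by
  rw [integral_integral_swap, ← integral_const_mul]
  · apply integral_congr_ae
    filter_upwards [ae_mem_Ioo t] with u hu
    rw [integral_mul_const, triKernel_integral α hα₁ hα₂ u t hu.1 hu.2]
  · have hm : Measurable (Function.uncurry fun s u => triKernel α t s u * g u) :=
      (triKernel_measurable α t).mul (hgm.comp measurable_snd)
    rw [integrable_prod_iff' hm.aestronglyMeasurable]
    constructor
    · filter_upwards [ae_mem_Ioo t] with u hu
      exact (triKernel_integrable α hα₁ hα₂ u t hu.1 hu.2).mul_const (g u)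
    · refine (hg.norm.const_mul (Real.Gamma α * Real.Gamma (1 - α))).congr ?_
      filter_upwards [ae_mem_Ioo t] with u hu
      rw [← triKernel_integral α hα₁ hα₂ u t hu.1 hu.2, ← integral_mul_const]
      apply setIntegral_congr_fun measurableSet_Ioc
      intro s hs
      simp only [Function.uncurry]
      rw [norm_mul, Real.norm_of_nonneg (triKernel_nonneg α t s u hs.2)]

/-- for `0 < α < 1` and `y` continuously differentiable on `[0, T]`,
the Riemann--Liouville integral of order `α` of the Caputo derivative of order `α`
of `y` satisfies `(I^α (^C D^α y))(t) = y(t) - y(0)` for all `0 < t ≤ T`. -/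
theorem rlInt_caputoDeriv (α : ℝ) (hα₁ : 0 < α) (hα₂ : α < 1) (T : ℝ) (hT : 0 < T)
    (y : ℝ → ℝ) (hy : ContDiffOn ℝ 1 y (Set.Icc 0 T)) :
    ∀ t : ℝ, 0 < t → t ≤ T → rlInt α (caputoDeriv α y) t = y t - y 0 := by
  intro t ht htT
  have hsub : Icc 0 t ⊆ Icc 0 T := Icc_subset_Icc le_rfl htT
  have hd : ∀ x ∈ Ioo 0 t, HasDerivAt y (deriv y x) x := by
    intro x hx
    have hn : Icc 0 T ∈ nhds x := Icc_mem_nhds hx.1 (hx.2.trans_le htT)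
    exact ((hy.contDiffAt hn).differentiableAt (by norm_num)).hasDerivAt
  have hgi : IntegrableOn (deriv y) (Ioc 0 t) := by
    have hc : ContinuousOn (derivWithin y (Icc 0 T)) (Icc 0 T) :=
      hy.continuousOn_derivWithin (uniqueDiffOn_Icc hT) le_rfl
    have h1 : IntegrableOn (derivWithin y (Icc 0 T)) (Ioc 0 t) :=
      ((hc.mono hsub).integrableOn_Icc).mono_set Ioc_subset_Icc_self
    refine Integrable.congr h1 ?_
    filter_upwards [ae_mem_Ioo t] with x hx
    exact derivWithin_of_mem_nhds (Icc_mem_nhds hx.1 (hx.2.trans_le htT))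
  have hftc : ∫ u in Ioc 0 t, deriv y u = y t - y 0 := by
    rw [← intervalIntegral.integral_of_le ht.le]
    exact intervalIntegral.integral_eq_sub_of_hasDerivAt_of_le ht.le
      (hy.continuousOn.mono hsub) hd ((intervalIntegrable_iff_integrableOn_Ioc_of_le ht.le).2 hgi)
  have hF := fubini_kernel α hα₁ hα₂ t (deriv y) (measurable_deriv y) hgi
  have hG1 := (Real.Gamma_pos_of_pos hα₁).ne'
  have hG2 := (Real.Gamma_pos_of_pos (sub_pos.2 hα₂)).ne'
  have hmain : ∫ s in (0 : ℝ)..t, (t - s) ^ (α - 1) * caputoDeriv α y s =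
      (1 / Real.Gamma (1 - α)) *
        ∫ s in Ioc 0 t, ∫ u in Ioc 0 t, triKernel α t s u * deriv y u := by
    rw [intervalIntegral.integral_of_le ht.le, ← integral_const_mul]
    apply setIntegral_congr_fun measurableSet_Ioc
    intro s hs
    simp only [caputoDeriv]
    rw [triKernel_inner α t s hs]
    ring
  rw [rlInt, hmain, hF, hftc]
  field_simp
end
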